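/- arXiv:2508.05400 — 4 statements merged into one kernel-verified Lean document; each statement's English description precedes it below -/
import Mathlib

section
/- Let Q ∈ ℝ^{n×k} have linearly independent columns and let Ω ∈ ℝ^{d×n} be an ε-embedding (0 ≤ ε < 1) for the column span of Q, with ΩQ of full column rank. Then κ(Q) ≤ √((1+ε)/(1−ε))·κ(ΩQ), where κ(M) = σ_max(M)/σ_min(M). In particular, if ΩQ has orthonormal columns then κ(Q) ≤ √((1+ε)/(1−ε)). -/
open Matrix

/-- Euclidean (ℓ²) norm of a vector in `Fin n → ℝ`. -/
noncomputable def eNorm {n : ℕ} (x : Fin n → ℝ) : ℝ :=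
  ‖(WithLp.equiv 2 (Fin n → ℝ)).symm x‖

/-- `Ω` is an ε-embedding for the set `K ⊆ ℝⁿ`. -/
def IsEpsEmbedding {d n : ℕ} (Ω : Matrix (Fin d) (Fin n) ℝ) (ε : ℝ)
    (K : Set (Fin n → ℝ)) : Prop :=
  ∀ x ∈ K, (1 - ε) * eNorm x ^ 2 ≤ eNorm (Ω.mulVec x) ^ 2 ∧
    eNorm (Ω.mulVec x) ^ 2 ≤ (1 + ε) * eNorm x ^ 2

/-- Smallest singular value: infimum of `‖My‖` over unit vectors `y`. -/
noncomputable def sigmaMin {m k : ℕ} (M : Matrix (Fin m) (Fin k) ℝ) : ℝ :=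
  sInf {r | ∃ y : Fin k → ℝ, eNorm y = 1 ∧ r = eNorm (M.mulVec y)}

/-- Largest singular value: supremum of `‖My‖` over unit vectors `y`. -/
noncomputable def sigmaMax {m k : ℕ} (M : Matrix (Fin m) (Fin k) ℝ) : ℝ :=
  sSup {r | ∃ y : Fin k → ℝ, eNorm y = 1 ∧ r = eNorm (M.mulVec y)}

/-- Condition number `κ(M) = σ_max(M) / σ_min(M)`. -/
noncomputable def kappa {m k : ℕ} (M : Matrix (Fin m) (Fin k) ℝ) : ℝ :=
  sigmaMax M / sigmaMin M

lemma eNorm_nonneg' {n : ℕ} (x : Fin n → ℝ) : 0 ≤ eNorm x := norm_nonneg _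

lemma le_of_sq_le_sq_aux {a b : ℝ} (h : a ^ 2 ≤ b ^ 2) (hb : 0 ≤ b) : a ≤ b :=
  (le_abs_self a).trans (abs_le_of_sq_le_sq h hb)

lemma eNorm_sq {n : ℕ} (x : Fin n → ℝ) : eNorm x ^ 2 = x ⬝ᵥ x := by
  unfold eNorm
  rw [EuclideanSpace.norm_sq_eq]
  simp [dotProduct, sq]

lemma exists_upper {m k : ℕ} (M : Matrix (Fin m) (Fin k) ℝ) :
    ∃ C : ℝ, ∀ y, eNorm (M.mulVec y) ≤ C * eNorm y := by
  let L := LinearMap.toContinuousLinearMap (Matrix.toEuclideanLin M)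
  exact ⟨‖L‖, fun y => L.le_opNorm (WithLp.toLp 2 y)⟩

lemma exists_lower {m k : ℕ} (M : Matrix (Fin m) (Fin k) ℝ)
    (h : LinearIndependent ℝ (fun j : Fin k => Mᵀ j)) :
    ∃ c : ℝ, 0 < c ∧ ∀ y, c * eNorm y ≤ eNorm (M.mulVec y) := by
  have hi : Function.Injective M.mulVec := Matrix.mulVec_injective_iff.2 h
  have hk : LinearMap.ker (Matrix.toEuclideanLin M) = ⊥ := by
    rw [LinearMap.ker_eq_bot]
    intro x y hxy
    have h2 : M.mulVec x.ofLp = M.mulVec y.ofLp := congrArg WithLp.ofLp hxy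
    exact WithLp.ofLp_injective 2 (hi h2)
  obtain ⟨K, hK, hL⟩ := LinearMap.exists_antilipschitzWith _ hk
  have hK' : (0 : ℝ) < K := by exact_mod_cast hK
  refine ⟨(K : ℝ)⁻¹, inv_pos.2 hK', fun y => ?_⟩
  have h3 := hL.le_mul_norm_sub (WithLp.toLp 2 y) 0
  rw [map_zero, add_zero, add_zero, norm_neg, norm_neg] at h3
  rw [inv_mul_le_iff₀ hK']
  exact h3

lemma exists_unit {k : ℕ} (hk : k ≠ 0) : ∃ y : Fin k → ℝ, eNorm y = 1 := by
  have : NeZero k := ⟨hk⟩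
  refine ⟨Pi.single 0 1, ?_⟩
  have h := eNorm_sq (Pi.single (0 : Fin k) (1 : ℝ))
  rw [single_one_dotProduct, Pi.single_eq_same] at h
  nlinarith [eNorm_nonneg' (Pi.single (0 : Fin k) (1 : ℝ))]

theorem stmt_1 {n k d : ℕ} (ε : ℝ) (hε0 : 0 ≤ ε) (hε1 : ε < 1)
    (Q : Matrix (Fin n) (Fin k) ℝ) (Ω : Matrix (Fin d) (Fin n) ℝ)
    (hQ : LinearIndependent ℝ (fun j : Fin k => Qᵀ j))
    (hΩQ : LinearIndependent ℝ (fun j : Fin k => (Ω * Q)ᵀ j))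
    (hemb : IsEpsEmbedding Ω ε (Set.range Q.mulVec)) :
    kappa Q ≤ Real.sqrt ((1 + ε) / (1 - ε)) * kappa (Ω * Q) ∧
      ((Ω * Q)ᵀ * (Ω * Q) = 1 → kappa Q ≤ Real.sqrt ((1 + ε) / (1 - ε))) := by
  rcases eq_or_ne k 0 with rfl | hk
  · have h0 : ∀ {m : ℕ} (M : Matrix (Fin m) (Fin 0) ℝ), kappa M = 0 := by
      intro m M
      have : {r | ∃ y : Fin 0 → ℝ, eNorm y = 1 ∧ r = eNorm (M.mulVec y)} = ∅ := by
        ext r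
        simp only [Set.mem_ofPred_eq, Set.mem_empty_iff_false, iff_false]
        rintro ⟨y, hy, -⟩
        have h := eNorm_sq y
        rw [hy] at h
        simp at h
      rw [kappa, sigmaMax, this, Real.sSup_empty, zero_div]
    rw [h0, h0]
    exact ⟨by simp, fun _ => Real.sqrt_nonneg _⟩
  obtain ⟨y₀, hy₀⟩ := exists_unit hk
  have ha : 0 < 1 - ε := by linarith
  have hb : 0 < 1 + ε := by linarith
  have hsa := Real.sqrt_pos.2 ha
  have hsb := Real.sqrt_pos.2 hb
  have h1 : ∀ y, √(1 - ε) * eNorm (Q.mulVec y) ≤ eNorm ((Ω * Q).mulVec y) := by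
    intro y
    have h := (hemb _ ⟨y, rfl⟩).1
    rw [Matrix.mulVec_mulVec] at h
    refine le_of_sq_le_sq_aux ?_ (eNorm_nonneg' _)
    rwa [mul_pow, Real.sq_sqrt ha.le]
  have h2 : ∀ y, eNorm ((Ω * Q).mulVec y) ≤ √(1 + ε) * eNorm (Q.mulVec y) := by
    intro y
    have h := (hemb _ ⟨y, rfl⟩).2
    rw [Matrix.mulVec_mulVec] at h
    refine le_of_sq_le_sq_aux ?_ (mul_nonneg hsb.le (eNorm_nonneg' _))
    rwa [mul_pow, Real.sq_sqrt hb.le]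
  have hle : ∀ {m : ℕ} (M : Matrix (Fin m) (Fin k) ℝ) (y : Fin k → ℝ), eNorm y = 1 →
      sigmaMin M ≤ eNorm (M.mulVec y) ∧ eNorm (M.mulVec y) ≤ sigmaMax M := by
    intro m M y hy
    constructor
    · refine csInf_le ⟨0, ?_⟩ ⟨y, hy, rfl⟩
      rintro r ⟨z, -, rfl⟩
      exact eNorm_nonneg' _
    · obtain ⟨C, hC⟩ := exists_upper M
      refine le_csSup ⟨C, ?_⟩ ⟨y, hy, rfl⟩
      rintro r ⟨z, hz, rfl⟩
      simpa [hz] using hC z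
  have hmin : ∀ {m : ℕ} (M : Matrix (Fin m) (Fin k) ℝ) (c : ℝ),
      (∀ y, eNorm y = 1 → c ≤ eNorm (M.mulVec y)) → c ≤ sigmaMin M := by
    intro m M c h
    refine le_csInf ⟨_, y₀, hy₀, rfl⟩ ?_
    rintro r ⟨z, hz, rfl⟩
    exact h z hz
  have hmax : ∀ {m : ℕ} (M : Matrix (Fin m) (Fin k) ℝ) (c : ℝ),
      (∀ y, eNorm y = 1 → eNorm (M.mulVec y) ≤ c) → sigmaMax M ≤ c := by
    intro m M c h
    refine csSup_le ⟨_, y₀, hy₀, rfl⟩ ?_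
    rintro r ⟨z, hz, rfl⟩
    exact h z hz
  have hpos : 0 < sigmaMin (Ω * Q) := by
    obtain ⟨c, hc, h⟩ := exists_lower _ hΩQ
    refine hc.trans_le (hmin _ _ fun y hy => ?_)
    simpa [hy] using h y
  have hMax : sigmaMax Q ≤ sigmaMax (Ω * Q) / √(1 - ε) := by
    refine hmax _ _ fun y hy => ?_
    rw [le_div_iff₀ hsa, mul_comm]
    exact (h1 y).trans (hle _ y hy).2
  have hMin : sigmaMin (Ω * Q) / √(1 + ε) ≤ sigmaMin Q := by
    refine hmin _ _ fun y hy => ?_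
    rw [div_le_iff₀ hsb, mul_comm]
    exact (hle _ y hy).1.trans (h2 y)
  have hM0 : 0 ≤ sigmaMax (Ω * Q) := (eNorm_nonneg' _).trans (hle _ y₀ hy₀).2
  have main : kappa Q ≤ √((1 + ε) / (1 - ε)) * kappa (Ω * Q) := by
    calc kappa Q ≤ (sigmaMax (Ω * Q) / √(1 - ε)) / (sigmaMin (Ω * Q) / √(1 + ε)) :=
          div_le_div₀ (by positivity) hMax (by positivity) hMin
      _ = √((1 + ε) / (1 - ε)) * kappa (Ω * Q) := by
          rw [Real.sqrt_div hb.le, kappa]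
          field_simp
  refine ⟨main, fun ho => ?_⟩
  have hn : ∀ y, eNorm y = 1 → eNorm ((Ω * Q).mulVec y) = 1 := by
    intro y hy
    have h : eNorm ((Ω * Q).mulVec y) ^ 2 = eNorm y ^ 2 := by
      rw [eNorm_sq, eNorm_sq, Matrix.dotProduct_mulVec, Matrix.vecMul_mulVec, ho,
        Matrix.vecMul_one]
    rw [hy] at h
    nlinarith [eNorm_nonneg' ((Ω * Q).mulVec y)]
  have hk1 : kappa (Ω * Q) ≤ 1 :=
    div_le_one_of_le₀ ((hmax _ 1 fun y hy => (hn y hy).le).trans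
      (hmin _ 1 fun y hy => (hn y hy).ge)) hpos.le
  exact main.trans (mul_le_of_le_one_right (Real.sqrt_nonneg _) hk1)
end

section
/- Let A ∈ ℝ^{n×n}, let u₁ ∈ ℝ^n satisfy ‖Ω·u₁‖ = 1 for Ω ∈ ℝ^{d×n}, and define A₁ := (I − u₁·(Ω·u₁)ᵀ·Ω)·A. If (λ, x) is an eigenpair of A₁ with λ ≠ 0, i.e., A₁·x = λ·x and x ≠ 0, then: (i) x is sketch-orthogonal to u₁, i.e., (Ω·u₁)ᵀ·Ω·x = 0; and (ii) A·x = λ·x + α·u₁ where α := (Ω·u₁)ᵀ·Ω·A·x, so that A·x lies in the span of {u₁, x}. -/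
open Matrix

theorem stmt_10 {n d : ℕ} (A : Matrix (Fin n) (Fin n) ℝ) (u₁ : Fin n → ℝ)
    (Ω : Matrix (Fin d) (Fin n) ℝ) (hu : eNorm (Ω.mulVec u₁) = 1)
    (A₁ : Matrix (Fin n) (Fin n) ℝ)
    (hA₁ : A₁ = (1 - vecMulVec u₁ (Matrix.vecMul (Ω.mulVec u₁) Ω)) * A)
    (lam : ℝ) (x : Fin n → ℝ) (hlam : lam ≠ 0) (hx : x ≠ 0)
    (heig : A₁.mulVec x = lam • x) :
    Ω.mulVec u₁ ⬝ᵥ Ω.mulVec x = 0 ∧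
      A.mulVec x = lam • x + (Ω.mulVec u₁ ⬝ᵥ Ω.mulVec (A.mulVec x)) • u₁ ∧
      A.mulVec x ∈ Submodule.span ℝ {u₁, x} := by
  have h1 : A.mulVec x = lam • x + (Ω.mulVec u₁ ⬝ᵥ Ω.mulVec (A.mulVec x)) • u₁ := by
    rw [← heig, hA₁, ← Matrix.mulVec_mulVec, Matrix.sub_mulVec, Matrix.one_mulVec,
      Matrix.vecMulVec_mulVec, ← Matrix.dotProduct_mulVec]
    ext i
    simp [mul_comm]
  have hn : Ω.mulVec u₁ ⬝ᵥ Ω.mulVec u₁ = 1 := by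
    have h2 : eNorm (Ω.mulVec u₁) ^ 2 = 1 := by rw [hu]; norm_num
    unfold eNorm at h2
    rw [EuclideanSpace.norm_sq_eq] at h2
    rw [← h2]
    simp [dotProduct, sq]
  refine ⟨?_, h1, ?_⟩
  · have h3 := congrArg (fun v => Ω.mulVec u₁ ⬝ᵥ Ω.mulVec v) h1
    simp only [Matrix.mulVec_add, Matrix.mulVec_smul, dotProduct_add, dotProduct_smul, hn,
      smul_eq_mul, mul_one] at h3
    have h4 : lam * (Ω.mulVec u₁ ⬝ᵥ Ω.mulVec x) = 0 := by linarith
    exact (mul_eq_zero.mp h4).resolve_left hlam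
  · rw [Submodule.mem_span_pair]
    exact ⟨_, lam, by rw [add_comm]; exact h1.symm⟩
end

section
/- Let u₁, u₂ ∈ ℝ^n and Ω ∈ ℝ^{d×n} satisfy ‖Ω·u₁‖ = ‖Ω·u₂‖ = 1 and (Ω·u₁)ᵀ·(Ω·u₂) = 0. Let P₁ := u₁·(Ω·u₁)ᵀ·Ω, P₂ := u₂·(Ω·u₂)ᵀ·Ω, and with U₁₂ := (u₁ u₂) ∈ ℝ^{n×2} let P₁₂ := U₁₂·(Ω·U₁₂)ᵀ·Ω. Then (I − P₂)·(I − P₁) = I − P₁₂ = I − P₁ − P₂; in particular, deflating u₁ and u₂ sequentially equals deflating them simultaneously. -/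
open Matrix

theorem stmt_11 {n d : ℕ} (u₁ u₂ : Fin n → ℝ) (Ω : Matrix (Fin d) (Fin n) ℝ)
    (hu₁ : eNorm (Ω.mulVec u₁) = 1) (hu₂ : eNorm (Ω.mulVec u₂) = 1)
    (horth : Ω.mulVec u₁ ⬝ᵥ Ω.mulVec u₂ = 0)
    (U12 : Matrix (Fin n) (Fin 2) ℝ) (hU12 : U12 = of fun i j => ![u₁ i, u₂ i] j)
    (P1 P2 P12 : Matrix (Fin n) (Fin n) ℝ)
    (hP1 : P1 = vecMulVec u₁ (Matrix.vecMul (Ω.mulVec u₁) Ω))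
    (hP2 : P2 = vecMulVec u₂ (Matrix.vecMul (Ω.mulVec u₂) Ω))
    (hP12 : P12 = U12 * (Ω * U12)ᵀ * Ω) :
    (1 - P2) * (1 - P1) = 1 - P12 ∧ 1 - P12 = 1 - P1 - P2 := by
  have h0 : P2 * P1 = 0 := by
    rw [hP1, hP2, vecMulVec_mul_vecMulVec, ← dotProduct_mulVec, dotProduct_comm, horth]
    ext i j
    simp [vecMulVec_apply]
  have h12 : P12 = P1 + P2 := by
    have e : U12 * (Ω * U12)ᵀ = vecMulVec u₁ (Ω.mulVec u₁) + vecMulVec u₂ (Ω.mulVec u₂) := by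
      ext i j
      simp [hU12, Matrix.mul_apply, Fin.sum_univ_two, vecMulVec_apply, mulVec, dotProduct, mul_comm (Ω _ _)]
    rw [hP12, e, Matrix.add_mul, vecMulVec_mul, vecMulVec_mul, hP1, hP2]
  constructor
  · rw [sub_mul, mul_sub, mul_sub, h0, h12]
    simp only [one_mul, mul_one]
    abel
  · rw [h12]
    abel
end

section
/- Let A ∈ ℝ^{n×n}, V ∈ ℝ^{n×k}, v ∈ ℝ^n, β ∈ ℝ, and let H ∈ ℝ^{k×k} be upper-Hessenberg with A·V = V·H + β·v·e_kᵀ. Suppose Ω·V = Q·R where Q ∈ ℝ^{d×k} has orthonormal columns and R ∈ ℝ^{k×k} is upper triangular and invertible. Then A·(V·R⁻¹) = (V·R⁻¹)·(R·H·R⁻¹) + β̃·v·e_kᵀ with β̃ = β·(R_{kk})⁻¹, the matrix R·H·R⁻¹ is upper-Hessenberg, and Ω·(V·R⁻¹) = Q has orthonormal columns, so V·R⁻¹ is sketch-orthonormal; i.e., the re-orthogonalization by R⁻¹ preserves the randomized Arnoldi structure. -/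
open Matrix

/-- `M` is sketch-orthonormal w.r.t. `Ω` if `(ΩM)ᵀ(ΩM) = I`. -/
def SketchOrthonormal {d n : ℕ} {m : Type*} [Fintype m] [DecidableEq m]
    (Ω : Matrix (Fin d) (Fin n) ℝ) (M : Matrix (Fin n) m ℝ) : Prop :=
  (Ω * M)ᵀ * (Ω * M) = 1

theorem stmt_18 {n k d : ℕ} (A : Matrix (Fin n) (Fin n) ℝ)
    (V : Matrix (Fin n) (Fin (k + 1)) ℝ) (v : Fin n → ℝ) (β : ℝ)
    (H : Matrix (Fin (k + 1)) (Fin (k + 1)) ℝ) (Ω : Matrix (Fin d) (Fin n) ℝ)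
    (hH : ∀ i j : Fin (k + 1), (j : ℕ) + 1 < (i : ℕ) → H i j = 0)
    (hdec : A * V = V * H + β • vecMulVec v (Pi.single (Fin.last k) 1))
    (Q : Matrix (Fin d) (Fin (k + 1)) ℝ)
    (R : Matrix (Fin (k + 1)) (Fin (k + 1)) ℝ)
    (hQR : Ω * V = Q * R) (hQ : Qᵀ * Q = 1)
    (hR : R.BlockTriangular id) (hRunit : IsUnit R) :
    A * (V * R⁻¹) = (V * R⁻¹) * (R * H * R⁻¹) +
        (β * (R (Fin.last k) (Fin.last k))⁻¹) •
          vecMulVec v (Pi.single (Fin.last k) 1) ∧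
      (∀ i j : Fin (k + 1), (j : ℕ) + 1 < (i : ℕ) → (R * H * R⁻¹) i j = 0) ∧
      Ω * (V * R⁻¹) = Q ∧
      SketchOrthonormal Ω (V * R⁻¹) := by
  have hdet : IsUnit R.det := (Matrix.isUnit_iff_isUnit_det R).1 hRunit
  have h1 : R * R⁻¹ = 1 := Matrix.mul_nonsing_inv R hdet
  have h2 : R⁻¹ * R = 1 := Matrix.nonsing_inv_mul R hdet
  haveI : Invertible R := hRunit.invertible
  have hS : (R⁻¹).BlockTriangular id := Matrix.blockTriangular_inv_of_blockTriangular hR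
  generalize R⁻¹ = S at *
  have hΩ : Ω * (V * S) = Q := by
    rw [← Matrix.mul_assoc, hQR, Matrix.mul_assoc, h1, Matrix.mul_one]
  have hlast : S (Fin.last k) (Fin.last k) = (R (Fin.last k) (Fin.last k))⁻¹ := by
    have h := congrFun (congrFun h2 (Fin.last k)) (Fin.last k)
    rw [Matrix.mul_apply, Finset.sum_eq_single (Fin.last k), Matrix.one_apply_eq] at h
    · exact eq_inv_of_mul_eq_one_left h
    · intro b _ hb
      rw [hS (show id b < id (Fin.last k) from Fin.lt_last_iff_ne_last.2 hb), zero_mul]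
    · simp
  refine ⟨?_, ?_, hΩ, ?_⟩
  · have e1 : (V * S) * (R * H * S) = V * H * S := by
      calc (V * S) * (R * H * S) = V * (S * R) * H * S := by simp only [Matrix.mul_assoc]
        _ = _ := by rw [h2, Matrix.mul_one]
    rw [e1, ← Matrix.mul_assoc, hdec, Matrix.add_mul, Matrix.smul_mul, mul_smul, ← hlast]
    congr 2
    ext i j
    rw [Matrix.vecMulVec_mul]
    simp only [Matrix.vecMulVec_apply, Matrix.smul_apply, smul_eq_mul,
      Matrix.single_one_vecMul, Matrix.row_apply]
    by_cases hj : j = Fin.last k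
    · subst hj
      simp [mul_comm]
    · rw [hS (show id j < id (Fin.last k) from Fin.lt_last_iff_ne_last.2 hj)]
      simp [hj]
  · intro i j hij
    rw [Matrix.mul_apply]
    refine Finset.sum_eq_zero fun b _ => ?_
    by_cases hb : j < b
    · rw [hS (show id j < id b from hb), mul_zero]
    · rw [Matrix.mul_apply, Finset.sum_eq_zero, zero_mul]
      intro a _
      by_cases ha : a < i
      · rw [hR (show id a < id i from ha), zero_mul]
      · rw [hH a b, mul_zero]
        have := Fin.le_def.1 (not_lt.1 hb)
        have := Fin.le_def.1 (not_lt.1 ha)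
        omega
  · unfold SketchOrthonormal
    rw [hΩ, hQ]
end
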